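/- arXiv:0903.5125 — 2 statements merged into one kernel-verified Lean document; each statement's English description precedes it below -/
import Mathlib

section
/- There exist a harmonic function h on the unit disc D and a constant B > 0 such that |h(z)| ≤ B|z| for all z ∈ D and, for every θ ∈ [0,2π), max_{1/6 < r < 1/3} h(re^{iθ}) ≥ 1. -/
open Filter

noncomputable section

/-- `h` is harmonic on the open unit disc; on the (simply connected) disc this is
equivalent to `h` being the real part of a holomorphic function. -/
def HarmonicOnDisc (h : ℂ → ℝ) : Prop :=
  ∃ F : ℂ → ℂ, DifferentiableOn ℂ F (Metric.ball 0 1) ∧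
    ∀ z ∈ Metric.ball (0:ℂ) 1, h z = (F z).re

/-- The uniform closure of the complex polynomials on `K`. -/
def polynomialClosure (K : Set ℂ) [CompactSpace K] : Subalgebra ℂ C(K, ℂ) :=
  (polynomialFunctions K).topologicalClosure

/-- The function `z ↦ z - q` on `K`. -/
def subConst (K : Set ℂ) (q : ℂ) : C(K, ℂ) := ⟨fun z => z - q, by fun_prop⟩

/-- The pole `q` is removable: `1 / (z - q)` is a uniform limit of polynomials on `K`. -/
def PoleApproximable (K : Set ℂ) [CompactSpace K] (q : ℂ) : Prop :=
  ∃ b ∈ polynomialClosure K, b * subConst K q = 1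

theorem exists_mul_one_sub_eq_one {K : Set ℂ} [CompactSpace K] {a : C(K, ℂ)}
    (ha : a ∈ polynomialClosure K) (hn : ‖a‖ < 1) :
    ∃ c ∈ polynomialClosure K, c * (1 - a) = 1 := by
  have : CompleteSpace (polynomialClosure K) :=
    (Subalgebra.isClosed_topologicalClosure (polynomialFunctions K)).completeSpace_coe
  obtain ⟨u, hu⟩ := isUnit_one_sub_of_norm_lt_one (x := (⟨a, ha⟩ : polynomialClosure K)) hn
  refine ⟨(↑u⁻¹ : polynomialClosure K), Subtype.property _, ?_⟩
  have h := u.inv_mul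
  rw [hu] at h
  exact congrArg Subtype.val h

theorem PoleApproximable.move {K : Set ℂ} [CompactSpace K] {p q : ℂ}
    (hp : PoleApproximable K p) (h : ∀ z ∈ K, ‖q - p‖ < ‖z - p‖) :
    PoleApproximable K q := by
  obtain ⟨b, hb, hbp⟩ := hp
  have hn : ‖(q - p) • b‖ < 1 := by
    rw [ContinuousMap.norm_lt_iff _ one_pos]
    intro z
    have h1 : ‖b z‖ * ‖(z : ℂ) - p‖ = 1 := by
      rw [← norm_mul]
      simpa [subConst] using congrArg norm (DFunLike.congr_fun hbp z)
    have h2 : 0 < ‖b z‖ := by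
      by_contra! h0
      have : ‖b z‖ = 0 := le_antisymm h0 (norm_nonneg _)
      simp [this] at h1
    rw [ContinuousMap.smul_apply, norm_smul, ← h1, mul_comm]
    exact mul_lt_mul_of_pos_left (h z z.2) h2
  obtain ⟨c, hc, hcb⟩ := exists_mul_one_sub_eq_one (Subalgebra.smul_mem _ hb (q - p)) hn
  refine ⟨c * b, mul_mem hc hb, ?_⟩
  have hq : subConst K q = subConst K p - (q - p) • 1 := by
    ext z; simp [subConst]
  rw [← hcb, hq, mul_assoc, mul_sub, hbp, mul_smul_comm, mul_one]

theorem poleApproximable_of_norm_lt {K : Set ℂ} [CompactSpace K] {q : ℂ}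
    (h : ∀ z ∈ K, ‖z‖ < ‖q‖) (hq : q ≠ 0) : PoleApproximable K q := by
  have hX : subConst K 0 ∈ polynomialClosure K := by
    refine Subalgebra.le_topologicalClosure _ ?_
    refine ⟨Polynomial.X, trivial, ?_⟩
    ext z; simp [subConst]
  have hn : ‖q⁻¹ • subConst K 0‖ < 1 := by
    rw [ContinuousMap.norm_lt_iff _ one_pos]
    intro z
    have := h z z.2
    simp only [subConst, ContinuousMap.smul_apply, ContinuousMap.coe_mk, sub_zero, norm_smul,
      norm_inv]
    rwa [inv_mul_lt_one₀ (norm_pos_iff.2 hq)]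
  obtain ⟨c, hc, hcb⟩ := exists_mul_one_sub_eq_one (Subalgebra.smul_mem _ hX q⁻¹) hn
  refine ⟨(-q⁻¹) • c, Subalgebra.smul_mem _ hc _, ?_⟩
  rw [← hcb]
  ext z
  simp [subConst]
  field_simp
  ring

/-- The left half of the circle of radius `21/20` with the right half of that of radius
`19/10`. -/
def twoArcs : Set ℂ :=
  {z | ‖z‖ = 21 / 20 ∧ z.re ≤ 0} ∪ {z | ‖z‖ = 19 / 10 ∧ 0 ≤ z.re}

theorem norm_le_of_mem_twoArcs {z : ℂ} (hz : z ∈ twoArcs) : ‖z‖ ≤ 19 / 10 := by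
  rcases hz with ⟨h, -⟩ | ⟨h, -⟩ <;> norm_num [h]

theorem isCompact_twoArcs : IsCompact twoArcs := by
  refine Metric.isCompact_of_isClosed_isBounded ?_ ?_
  · exact ((isClosed_eq continuous_norm continuous_const).inter
      (isClosed_le Complex.continuous_re continuous_const)).union
      ((isClosed_eq continuous_norm continuous_const).inter
      (isClosed_le continuous_const Complex.continuous_re))
  · exact (Metric.isBounded_closedBall (x := (0 : ℂ)) (r := 19 / 10)).subset
      fun z hz => by simpa using norm_le_of_mem_twoArcs hz

instance : CompactSpace twoArcs := isCompact_iff_compactSpace.1 isCompact_twoArcs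

theorem norm_sub_lt_of_mem_twoArcs {s t u v : ℝ}
    (h₁ : ∀ x y : ℝ, x ^ 2 + y ^ 2 = (21 / 20) ^ 2 → x ≤ 0 → y ≤ 21 / 20 →
      (u - s) ^ 2 + (v - t) ^ 2 < (x - s) ^ 2 + (y - t) ^ 2)
    (h₂ : ∀ x y : ℝ, x ^ 2 + y ^ 2 = (19 / 10) ^ 2 → 0 ≤ x → y ≤ 19 / 10 →
      (u - s) ^ 2 + (v - t) ^ 2 < (x - s) ^ 2 + (y - t) ^ 2) :
    ∀ z ∈ twoArcs, ‖(⟨u, v⟩ : ℂ) - ⟨s, t⟩‖ < ‖z - ⟨s, t⟩‖ := by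
  intro z hz
  rw [← sq_lt_sq₀ (norm_nonneg _) (norm_nonneg _), Complex.sq_norm, Complex.sq_norm,
    Complex.normSq_apply, Complex.normSq_apply]
  simp only [Complex.sub_re, Complex.sub_im, ← sq]
  have hn : z.re ^ 2 + z.im ^ 2 = ‖z‖ ^ 2 := by
    rw [Complex.sq_norm, Complex.normSq_apply]; ring
  have him := (le_abs_self _).trans (Complex.abs_im_le_norm z)
  rcases hz with ⟨h, h0⟩ | ⟨h, h0⟩ <;> rw [h] at hn him
  · exact h₁ _ _ hn h0 him
  · exact h₂ _ _ hn h0 him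

theorem poleApproximable_twoArcs_zero : PoleApproximable twoArcs 0 := by
  have h₆ : PoleApproximable twoArcs ⟨-7 / 10, 9 / 5⟩ := by
    refine poleApproximable_of_norm_lt (fun z hz => (norm_le_of_mem_twoArcs hz).trans_lt ?_) ?_
    · rw [← sq_lt_sq₀ (by norm_num) (norm_nonneg _), Complex.sq_norm, Complex.normSq_apply]
      norm_num
    · simp [Complex.ext_iff]
  have h₅ : PoleApproximable twoArcs ⟨-1 / 5, 8 / 5⟩ := h₆.move (norm_sub_lt_of_mem_twoArcs
    (fun x y h hx hy => by nlinarith [sq_nonneg (x + 19 / 50), sq_nonneg (y - 49 / 50)])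
    (fun x y h hx hy => by nlinarith [sq_nonneg (x + 69 / 100), sq_nonneg (y - 177 / 100)]))
  have h₄ : PoleApproximable twoArcs ⟨1 / 10, 29 / 20⟩ := h₅.move (norm_sub_lt_of_mem_twoArcs
    (fun x y h hx hy => by nlinarith [sq_nonneg (x + 13 / 100), sq_nonneg (y - 26 / 25)])
    (fun x y h hx hy => by nlinarith [sq_nonneg (x + 6 / 25), sq_nonneg (y - 189 / 100)]))
  have h₃ : PoleApproximable twoArcs ⟨2 / 5, 13 / 10⟩ := h₄.move (norm_sub_lt_of_mem_twoArcs
    (fun x y h hx hy => by nlinarith [sq_nonneg (x - 7 / 100), sq_nonneg (y - 21 / 20)])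
    (fun x y h hx hy => by nlinarith [sq_nonneg (x - 13 / 100), sq_nonneg (y - 19 / 10)]))
  have h₂ : PoleApproximable twoArcs ⟨3 / 4, 1⟩ := h₃.move (norm_sub_lt_of_mem_twoArcs
    (fun x y h hx hy => by nlinarith [sq_nonneg (x - 31 / 100), sq_nonneg (y - 1)])
    (fun x y h hx hy => by nlinarith [sq_nonneg (x - 14 / 25), sq_nonneg (y - 91 / 50)]))
  have h₁ : PoleApproximable twoArcs ⟨3 / 4, 1 / 2⟩ := h₂.move (norm_sub_lt_of_mem_twoArcs
    (fun x y h hx hy => by nlinarith [sq_nonneg (x - 63 / 100), sq_nonneg (y - 21 / 25)])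
    (fun x y h hx hy => by nlinarith [sq_nonneg (x - 57 / 50), sq_nonneg (y - 38 / 25)]))
  exact h₁.move (norm_sub_lt_of_mem_twoArcs
    (fun x y h hx hy => by nlinarith [sq_nonneg (x - 87 / 100), sq_nonneg (y - 29 / 50)])
    (fun x y h hx hy => by nlinarith [sq_nonneg (x - 79 / 50), sq_nonneg (y - 21 / 20)]))

theorem exists_polynomial_one_le_re_mul :
    ∃ Q : Polynomial ℂ, ∀ z ∈ twoArcs, 1 ≤ (2 * (z * Q.eval z)).re := by
  obtain ⟨b, hb, hbX⟩ := poleApproximable_twoArcs_zero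
  obtain ⟨g, hg, hbg⟩ := Metric.mem_closure_iff.1 hb (1 / 4) (by norm_num)
  obtain ⟨Q, -, rfl⟩ := hg
  refine ⟨Q, fun z hz => ?_⟩
  have h1 := (ContinuousMap.dist_apply_le_dist (f := b) (⟨z, hz⟩ : twoArcs)).trans_lt hbg
  have h2 : b ⟨z, hz⟩ * z = 1 := by
    simpa [subConst] using DFunLike.congr_fun hbX ⟨z, hz⟩
  rw [dist_eq_norm] at h1
  replace h1 : ‖b ⟨z, hz⟩ - Q.eval z‖ < 1 / 4 := by simpa using h1
  have h3 : ‖1 - z * Q.eval z‖ ≤ 1 / 2 := by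
    rw [← h2, mul_comm z, ← sub_mul, norm_mul]
    nlinarith [norm_le_of_mem_twoArcs hz, norm_nonneg z, norm_nonneg (b ⟨z, hz⟩ - Q.eval z)]
  have h4 := (Complex.re_le_norm _).trans h3
  rw [Complex.sub_re, Complex.one_re] at h4
  rw [show (2 : ℂ) = ((2 : ℝ) : ℂ) by norm_num, Complex.re_ofReal_mul]
  linarith

/-- There exist a harmonic function `h` on the unit disc and `B > 0` with `|h(z)| ≤ B|z|`
and `max_{1/6 < r < 1/3} h(re^{iθ}) ≥ 1` for every `θ ∈ [0, 2π)`. -/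
theorem stmt15 :
    ∃ h : ℂ → ℝ, HarmonicOnDisc h ∧
      ∃ B : ℝ, 0 < B ∧ (∀ z ∈ Metric.ball (0:ℂ) 1, |h z| ≤ B * ‖z‖) ∧
        ∀ θ ∈ Set.Ico (0:ℝ) (2 * Real.pi), ∃ r : ℝ, 1 / 6 < r ∧ r < 1 / 3 ∧
          1 ≤ h ((r : ℂ) * Complex.exp (Complex.I * (θ : ℂ))) := by
  obtain ⟨Q, hQ⟩ := exists_polynomial_one_le_re_mul
  refine ⟨fun z => (2 * (6 * z * Q.eval (6 * z))).re,
    ⟨fun z => 2 * (6 * z * Q.eval (6 * z)), ?_, fun _ _ => rfl⟩, ?_⟩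
  · have : Differentiable ℂ fun z : ℂ => Q.eval (6 * z) :=
      Q.differentiable.comp (differentiable_id.const_mul 6)
    exact Differentiable.differentiableOn (by fun_prop)
  obtain ⟨C, hC⟩ := (isCompact_closedBall (0 : ℂ) 1).exists_bound_of_continuousOn
    (f := fun z => Q.eval (6 * z)) (by fun_prop)
  have hC0 : 0 ≤ C := (norm_nonneg _).trans (hC 0 (by simp))
  refine ⟨12 * C + 1, by positivity, fun z hz => ?_, fun θ _ => ?_⟩
  · refine (Complex.abs_re_le_norm _).trans ?_
    have := hC z (Metric.ball_subset_closedBall hz)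
    simp only [norm_mul, Complex.norm_ofNat]
    nlinarith [norm_nonneg z, mul_le_mul_of_nonneg_left this (norm_nonneg z)]
  · have hnorm (r : ℝ) (hr : 0 ≤ r) :
        ‖6 * ((r : ℂ) * Complex.exp (Complex.I * (θ : ℂ)))‖ = 6 * r := by
      rw [mul_comm Complex.I, norm_mul, norm_mul, Complex.norm_exp_ofReal_mul_I,
        Complex.norm_of_nonneg hr]
      simp
    have hre (r : ℝ) :
        (6 * ((r : ℂ) * Complex.exp (Complex.I * (θ : ℂ)))).re = 6 * r * Real.cos θ := by
      rw [mul_comm Complex.I, show (6 : ℂ) = ((6 : ℝ) : ℂ) by norm_num, Complex.re_ofReal_mul,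
        Complex.re_ofReal_mul, Complex.exp_ofReal_mul_I_re, mul_assoc]
    rcases le_total (Real.cos θ) 0 with hc | hc
    · refine ⟨7 / 40, by norm_num, by norm_num, hQ _ (Or.inl ⟨?_, ?_⟩)⟩
      · rw [hnorm _ (by norm_num)]; norm_num
      · rw [hre]; linarith
    · refine ⟨19 / 60, by norm_num, by norm_num, hQ _ (Or.inr ⟨?_, ?_⟩)⟩
      · rw [hnorm _ (by norm_num)]; norm_num
      · rw [hre]; linarith
end
end

section
/- Let h be a harmonic function on the unit disc D and B > 0 a constant such that |h(z)| ≤ B|z| for all z ∈ D and max_{1/6 < r < 1/3} h(re^{iθ}) ≥ 1 for every θ ∈ [0,2π). Then if the integer A is large enough, the series u(z) = Σ_{k=0}^∞ A^k h(z^{2^{A^k}}) converges in D to a function of class K, and there exists d > 0 such that limsup_{r→1} u(re^{iθ}) / |log(1−r)| ≥ d for every θ ∈ [0,2π). -/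
open Filter

noncomputable section

/-- The class `K`: harmonic functions on the unit disc with
`u(z) ≤ C log(e/(1-|z|))`. -/
def ClassK (u : ℂ → ℝ) : Prop :=
  HarmonicOnDisc u ∧
    ∃ C : ℝ, ∀ z ∈ Metric.ball (0:ℂ) 1, u z ≤ C * Real.log (Real.exp 1 / (1 - ‖z‖))

open Finset in
/-- Two-fold Cauchy condensation: `∑ A^k r^(2^(A^k))` is dominated by `∑ r^j / j`. -/
theorem sum_pow_mul_lacunary_le {A : ℕ} (hA : 2 ≤ A) {r : ℝ} (hr0 : 0 ≤ r) (hr1 : r < 1)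
    (n : ℕ) :
    ∑ k ∈ range n, (A : ℝ) ^ k * r ^ 2 ^ A ^ k ≤ 4 * Real.log (Real.exp 1 / (1 - r)) := by
  have hlog : Real.log (Real.exp 1 / (1 - r)) = 1 - Real.log (1 - r) := by
    rw [Real.log_div (Real.exp_pos 1).ne' (by linarith), Real.log_exp]
  have hS : HasSum (fun j : ℕ => r ^ (j + 1) / ((j : ℝ) + 1)) (-Real.log (1 - r)) :=
    Real.hasSum_pow_div_log_of_abs_lt_one (by rwa [abs_of_nonneg hr0])
  have hS' (m : ℕ) : ∑ j ∈ Ico 2 (m + 1), r ^ j / (j : ℝ) ≤ -Real.log (1 - r) - r := by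
    have h1 := hS.summable.sum_le_tsum (range (m + 1)) (fun j _ => by positivity)
    rw [hS.tsum_eq, sum_range_succ'] at h1
    simp only [Nat.cast_zero, zero_add, pow_one, div_one] at h1
    have h2 : ∑ j ∈ Ico 2 (m + 1), r ^ j / (j : ℝ)
        ≤ ∑ j ∈ Ico 2 (m + 2), r ^ j / (j : ℝ) :=
      sum_le_sum_of_subset_of_nonneg (Ico_subset_Ico_right (by omega))
        (fun _ _ _ => by positivity)
    rw [sum_Ico_eq_sum_range _ 2 (m + 2), Nat.add_sub_cancel] at h2
    have h3 : ∑ k ∈ range m, r ^ (2 + k) / ((2 + k : ℕ) : ℝ)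
        = ∑ k ∈ range m, r ^ (k + 1 + 1) / (((k + 1 : ℕ) : ℝ) + 1) := by
      refine sum_congr rfl fun k _ => ?_
      rw [show 2 + k = k + 1 + 1 by omega]; push_cast; ring
    linarith
  have hC (m : ℕ) : ∑ k ∈ range (m + 1), r ^ 2 ^ k ≤ -2 * Real.log (1 - r) := by
    have h1 := sum_condensed_le (f := fun j : ℕ => r ^ j / (j : ℝ))
      (fun a b ha hab => by
        have ha' : (0 : ℝ) < a := by exact_mod_cast zero_lt_one.trans ha
        have hab' : (a : ℝ) ≤ b := by exact_mod_cast hab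
        exact div_le_div₀ (by positivity) (pow_le_pow_of_le_one hr0 hr1.le hab) ha' hab') m
    have h2 : ∑ k ∈ range (m + 1), ((2 ^ k : ℕ) : ℝ) * (r ^ 2 ^ k / ((2 ^ k : ℕ) : ℝ))
        = ∑ k ∈ range (m + 1), r ^ 2 ^ k := by
      refine sum_congr rfl fun k _ => ?_
      field_simp
    simp only [nsmul_eq_mul, h2, pow_one, Nat.cast_one, div_one, Nat.cast_ofNat] at h1
    linarith [hS' (2 ^ m)]
  have hB (m : ℕ) : ∑ k ∈ range m, (A : ℝ) ^ (k + 1) * r ^ 2 ^ A ^ (k + 1)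
      ≤ -4 * Real.log (1 - r) := by
    have h1 := sum_schlomilch_le' (f := fun j : ℕ => r ^ 2 ^ j) (u := fun k => A ^ k)
      (fun a b _ hab => pow_le_pow_of_le_one hr0 hr1.le (Nat.pow_le_pow_right (by norm_num) hab))
      (fun k => by positivity) (pow_right_mono₀ (by omega)) m
    have h2 : ∑ j ∈ Ico (A ^ 0 + 1) (A ^ m + 1), r ^ 2 ^ j
        ≤ ∑ j ∈ range (A ^ m + 1), r ^ 2 ^ j :=
      sum_le_sum_of_subset_of_nonneg (fun x hx => by simp at hx ⊢; omega)
        (fun _ _ _ => by positivity)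
    have h3 : ∑ k ∈ range m, (A : ℝ) ^ (k + 1) * r ^ 2 ^ A ^ (k + 1)
        ≤ 2 * ∑ k ∈ range m, (A ^ (k + 1) - A ^ k) • r ^ 2 ^ A ^ (k + 1) := by
      rw [mul_sum]
      refine sum_le_sum fun k _ => ?_
      rw [nsmul_eq_mul, Nat.cast_sub (Nat.pow_le_pow_right (by omega) (by omega)), ← mul_assoc]
      refine mul_le_mul_of_nonneg_right ?_ (by positivity)
      have : (2 : ℝ) ≤ A := by exact_mod_cast hA
      push_cast
      nlinarith [show (0 : ℝ) < (A : ℝ) ^ k by positivity, pow_succ (A : ℝ) k]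
    linarith [hC (A ^ m)]
  have hneg : Real.log (1 - r) ≤ 0 := Real.log_nonpos (by linarith) (by linarith)
  rcases n with _ | m
  · simp only [range_zero, sum_empty]; linarith
  · rw [sum_range_succ']
    have h0 : (A : ℝ) ^ 0 * r ^ 2 ^ A ^ 0 ≤ 1 := by
      rw [pow_zero, one_mul]
      exact pow_le_one₀ hr0 hr1.le
    linarith [hB m]

theorem summable_pow_mul_lacunary {A : ℕ} (hA : 2 ≤ A) {r : ℝ} (hr0 : 0 ≤ r) (hr1 : r < 1) :
    Summable fun n : ℕ => (A : ℝ) ^ n * r ^ 2 ^ A ^ n :=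
  summable_of_sum_range_le (fun n => by positivity) (sum_pow_mul_lacunary_le hA hr0 hr1)

/-- Lacunary superposition of holomorphic dilates preserves harmonicity on the disc. -/
theorem HarmonicOnDisc.tsum_lacunary {h : ℂ → ℝ} (hh : HarmonicOnDisc h) (h0 : h 0 = 0)
    {A : ℕ} (hA : 2 ≤ A) :
    HarmonicOnDisc fun z => ∑' n : ℕ, (A : ℝ) ^ n * h (z ^ 2 ^ A ^ n) := by
  obtain ⟨F, hF, hFh⟩ := hh
  have hmaps {ρ : ℝ} (hρ : ρ ≤ 1) {z : ℂ} (hz : ‖z‖ < ρ) (n : ℕ) :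
      ‖z ^ 2 ^ A ^ n‖ < ρ := by
    rw [norm_pow]
    exact (pow_le_of_le_one (norm_nonneg z) (hz.le.trans hρ) (by positivity)).trans_lt hz
  have hD : DifferentiableOn ℂ (dslope F 0) (Metric.ball 0 1) :=
    (Complex.differentiableOn_dslope (Metric.ball_mem_nhds 0 one_pos)).2 hF
  have hlocal (ρ : ℝ) (hρ0 : 0 < ρ) (hρ1 : ρ < 1) :
      ∃ M : ℝ, ∀ n : ℕ, ∀ z ∈ Metric.ball (0 : ℂ) ρ,
        ‖(A : ℂ) ^ n * (F (z ^ 2 ^ A ^ n) - F 0)‖ ≤ M * ((A : ℝ) ^ n * ρ ^ 2 ^ A ^ n) := by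
    obtain ⟨M, hM⟩ := (isCompact_closedBall (0 : ℂ) ρ).exists_bound_of_continuousOn
      (hD.continuousOn.mono (Metric.closedBall_subset_ball hρ1))
    refine ⟨M, fun n z hz => ?_⟩
    rw [mem_ball_zero_iff] at hz
    have h1 : F (z ^ 2 ^ A ^ n) - F 0 = (z ^ 2 ^ A ^ n) * dslope F 0 (z ^ 2 ^ A ^ n) := by
      simpa using (sub_smul_dslope F 0 (z ^ 2 ^ A ^ n)).symm
    have h2 := hM (z ^ 2 ^ A ^ n) (by simpa using (hmaps hρ1.le hz n).le)
    rw [h1, norm_mul, norm_mul, norm_pow, norm_pow, Complex.norm_natCast]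
    calc (A : ℝ) ^ n * (‖z‖ ^ 2 ^ A ^ n * ‖dslope F 0 (z ^ 2 ^ A ^ n)‖)
        ≤ (A : ℝ) ^ n * (ρ ^ 2 ^ A ^ n * M) := by gcongr
      _ = M * ((A : ℝ) ^ n * ρ ^ 2 ^ A ^ n) := by ring
  refine ⟨fun z => ∑' n : ℕ, (A : ℂ) ^ n * (F (z ^ 2 ^ A ^ n) - F 0), ?_, ?_⟩
  · intro z hz
    rw [mem_ball_zero_iff] at hz
    obtain ⟨ρ, hzρ, hρ1⟩ := exists_between hz
    have hρ0 : 0 < ρ := (norm_nonneg z).trans_lt hzρ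
    obtain ⟨M, hM⟩ := hlocal ρ hρ0 hρ1
    refine ((Complex.differentiableOn_tsum_of_summable_norm
      ((summable_pow_mul_lacunary hA hρ0.le hρ1).mul_left M) (fun n => ?_)
      Metric.isOpen_ball hM).differentiableAt
        (Metric.isOpen_ball.mem_nhds (by simpa using hzρ))).differentiableWithinAt
    refine ((hF.comp (by fun_prop) fun w hw => ?_).sub_const _).const_mul _
    rw [mem_ball_zero_iff] at hw ⊢
    exact (hmaps hρ1.le hw n).trans hρ1
  · intro z hz
    rw [mem_ball_zero_iff] at hz
    obtain ⟨ρ, hzρ, hρ1⟩ := exists_between hz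
    have hρ0 : 0 < ρ := (norm_nonneg z).trans_lt hzρ
    obtain ⟨M, hM⟩ := hlocal ρ hρ0 hρ1
    have hsum : Summable fun n : ℕ => (A : ℂ) ^ n * (F (z ^ 2 ^ A ^ n) - F 0) :=
      Summable.of_norm_bounded ((summable_pow_mul_lacunary hA hρ0.le hρ1).mul_left M)
        (fun n => hM n z (by simpa using hzρ))
    rw [Complex.re_tsum hsum]
    refine tsum_congr fun n => ?_
    rw [← Complex.ofReal_natCast, ← Complex.ofReal_pow, Complex.re_ofReal_mul, Complex.sub_re,
      ← hFh _ (by simpa using hmaps le_rfl hz n), ← hFh 0 (by simp), h0, sub_zero]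

theorem half_pow_two_pow_le {A k n : ℕ} (hA : 2 ≤ A) (hnk : n < k) :
    (1 / 2 : ℝ) ^ 2 ^ (A ^ k - A ^ n) ≤ ((A : ℝ) ^ k)⁻¹ ^ 2 := by
  have h1 : 2 * A ^ n ≤ A ^ k :=
    (Nat.mul_le_mul_right _ hA).trans (by
      rw [← pow_succ']; exact Nat.pow_le_pow_right (by omega) hnk)
  have h2 : A ^ k ≤ 2 * (A ^ k - A ^ n) := by omega
  have hpos : 0 < A ^ k := by positivity
  obtain ⟨x, hx⟩ : ∃ x, A ^ k - A ^ n = x + 1 := ⟨A ^ k - A ^ n - 1, by omega⟩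
  rw [hx] at h2 ⊢
  have h3 : 2 * (x + 1) ≤ 2 ^ (x + 1) := by
    rw [pow_succ']; exact Nat.mul_le_mul_left _ Nat.lt_two_pow_self
  have h4 : A ^ k ≤ 2 ^ (x + 1) := h2.trans h3
  calc (1 / 2 : ℝ) ^ 2 ^ (x + 1) ≤ (1 / 2) ^ ((x + 1) * 2) :=
        pow_le_pow_of_le_one (by norm_num) (by norm_num) (by omega)
    _ = ((2 : ℝ) ^ (x + 1))⁻¹ ^ 2 := by rw [pow_mul, one_div, inv_pow]
    _ ≤ ((A : ℝ) ^ k)⁻¹ ^ 2 := by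
        have h5 : (A : ℝ) ^ k ≤ 2 ^ (x + 1) := by exact_mod_cast h4
        have h6 : (0 : ℝ) < (A : ℝ) ^ k := by exact_mod_cast hpos
        gcongr

/-- If `h` is harmonic on the disc, `|h(z)| ≤ B|z|`, and `max_{1/6<r<1/3} h(re^{iθ}) ≥ 1`
for every `θ`, then for every large enough integer `A` the series
`u(z) = Σ_{k≥0} A^k h(z^{2^{A^k}})` converges in the disc to a function of class `K`, and
there is `d > 0` with `limsup_{r→1⁻} u(re^{iθ})/|log(1-r)| ≥ d` for every `θ ∈ [0, 2π)`
(here `limsup ≥ d` is expressed as: for every `ε > 0`, frequently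
`u(re^{iθ})/|log(1-r)| ≥ d - ε`). -/
theorem stmt16 (h : ℂ → ℝ) (B : ℝ) (hB : 0 < B)
    (hharm : HarmonicOnDisc h)
    (hbound : ∀ z ∈ Metric.ball (0:ℂ) 1, |h z| ≤ B * ‖z‖)
    (hmax : ∀ θ ∈ Set.Ico (0:ℝ) (2 * Real.pi), ∃ r : ℝ, 1 / 6 < r ∧ r < 1 / 3 ∧
      1 ≤ h ((r : ℂ) * Complex.exp (Complex.I * (θ : ℂ)))) :
    ∃ A₀ : ℕ, ∀ A : ℕ, A₀ ≤ A →
      (∀ z ∈ Metric.ball (0:ℂ) 1, Summable fun n : ℕ => (A : ℝ) ^ n * h (z ^ 2 ^ A ^ n)) ∧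
      ClassK (fun z => ∑' n : ℕ, (A : ℝ) ^ n * h (z ^ 2 ^ A ^ n)) ∧
      ∃ d : ℝ, 0 < d ∧ ∀ θ ∈ Set.Ico (0:ℝ) (2 * Real.pi), ∀ ε : ℝ, 0 < ε →
        ∃ᶠ r : ℝ in nhdsWithin 1 (Set.Iio 1),
          d - ε ≤ (∑' n : ℕ, (A : ℝ) ^ n *
              h (((r : ℂ) * Complex.exp (Complex.I * (θ : ℂ))) ^ 2 ^ A ^ n)) /
            |Real.log (1 - r)| := by
  obtain ⟨A₀, hA₀⟩ := exists_nat_ge (4 * B)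
  refine ⟨A₀ + 2, fun A hA => ?_⟩
  have hA2 : 2 ≤ A := by omega
  have hA2' : (2 : ℝ) ≤ A := by exact_mod_cast hA2
  have hAB : 4 * B + 1 ≤ A := by
    have : ((A₀ + 2 : ℕ) : ℝ) ≤ A := by exact_mod_cast hA
    push_cast at this; linarith
  have h0 : h 0 = 0 := by simpa using hbound 0 (by simp)
  have hterm (z : ℂ) (hz : ‖z‖ < 1) (n : ℕ) :
      |(A : ℝ) ^ n * h (z ^ 2 ^ A ^ n)| ≤ B * ((A : ℝ) ^ n * ‖z‖ ^ 2 ^ A ^ n) := by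
    have h1 : ‖z ^ 2 ^ A ^ n‖ < 1 := by
      rw [norm_pow]; exact pow_lt_one₀ (norm_nonneg z) hz (by positivity)
    have h2 := hbound _ (mem_ball_zero_iff.2 h1)
    rw [norm_pow] at h2
    rw [abs_mul, abs_of_nonneg (by positivity : (0 : ℝ) ≤ (A : ℝ) ^ n)]
    calc (A : ℝ) ^ n * |h (z ^ 2 ^ A ^ n)| ≤ (A : ℝ) ^ n * (B * ‖z‖ ^ 2 ^ A ^ n) := by gcongr
      _ = _ := by ring
  have hsumm (z : ℂ) (hz : ‖z‖ < 1) : Summable fun n : ℕ => (A : ℝ) ^ n * h (z ^ 2 ^ A ^ n) :=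
    Summable.of_norm_bounded ((summable_pow_mul_lacunary hA2 (norm_nonneg z) hz).mul_left B)
      (hterm z hz)
  refine ⟨fun z hz => hsumm z (by simpa using hz), ⟨hharm.tsum_lacunary h0 hA2, 4 * B, ?_⟩,
    1 / 4, by norm_num, ?_⟩
  · intro z hz
    rw [mem_ball_zero_iff] at hz
    refine (hsumm z hz).tsum_le_of_sum_range_le fun n => ?_
    calc ∑ k ∈ Finset.range n, (A : ℝ) ^ k * h (z ^ 2 ^ A ^ k)
        ≤ ∑ k ∈ Finset.range n, B * ((A : ℝ) ^ k * ‖z‖ ^ 2 ^ A ^ k) :=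
          Finset.sum_le_sum fun k _ => (le_abs_self _).trans (hterm z hz k)
      _ ≤ B * (4 * Real.log (Real.exp 1 / (1 - ‖z‖))) := by
          rw [← Finset.mul_sum]
          exact mul_le_mul_of_nonneg_left
            (sum_pow_mul_lacunary_le hA2 (norm_nonneg z) hz n) hB.le
      _ = _ := by ring
  intro θ _ ε hε
  have key (n : ℕ) : ∃ r : ℝ, r < 1 ∧ 1 - 5 * (1 / ((n : ℝ) + 1)) ≤ r ∧
      1 / 4 ≤ (∑' n : ℕ, (A : ℝ) ^ n *
        h (((r : ℂ) * Complex.exp (Complex.I * (θ : ℂ))) ^ 2 ^ A ^ n)) / |Real.log (1 - r)| := by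
    set N : ℕ := 2 ^ A ^ n with hN
    have hN0 : N ≠ 0 := by positivity
    have hNpos : (0 : ℝ) < N := by positivity
    have hAn : (1 : ℝ) ≤ (A : ℝ) ^ n := one_le_pow₀ (by linarith)
    obtain ⟨s, hs6, hs3, hs⟩ := hmax (toIcoMod Real.two_pi_pos 0 (N * θ))
      (by simpa using toIcoMod_mem_Ico Real.two_pi_pos 0 (N * θ))
    have hexp : Complex.exp (Complex.I * (toIcoMod Real.two_pi_pos 0 (N * θ) : ℝ))
        = Complex.exp (Complex.I * θ) ^ N := by
      rw [← Complex.exp_nat_mul, Complex.exp_eq_exp_iff_exists_int]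
      refine ⟨-toIcoDiv Real.two_pi_pos 0 (N * θ), ?_⟩
      rw [toIcoMod]
      push_cast [zsmul_eq_mul]
      ring
    rw [hexp] at hs
    have hs0 : 0 ≤ s := by linarith
    set r : ℝ := s ^ ((N : ℝ)⁻¹) with hr
    have hr0 : 0 ≤ r := Real.rpow_nonneg hs0 _
    have hrN : r ^ N = s := Real.rpow_inv_natCast_pow hs0 hN0
    have hr1 : r < 1 := Real.rpow_lt_one hs0 (by linarith) (by positivity)
    have hlow : 2 / 3 / (N : ℝ) ≤ 1 - r := by
      have h1 := one_add_mul_le_pow (a := r - 1) (by linarith) N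
      rw [add_sub_cancel, hrN] at h1
      rw [div_le_iff₀ hNpos]; nlinarith
    have hup : (1 - r) * N ≤ 5 := by
      have h1 : r ^ N ≤ Real.exp (-(1 - r)) ^ N :=
        pow_le_pow_left₀ hr0 (by linarith [Real.add_one_le_exp (-(1 - r))]) N
      rw [hrN, ← Real.exp_nat_mul, mul_neg, Real.exp_neg] at h1
      have h2 := Real.add_one_le_exp ((N : ℝ) * (1 - r))
      have h3 : Real.exp ((N : ℝ) * (1 - r)) < 6 := by
        have := hs6.trans_le h1
        rw [one_div] at this
        exact (inv_lt_inv₀ (by norm_num) (Real.exp_pos _)).1 this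
      linarith
    have hnN : (n : ℝ) + 1 ≤ N := by
      have h1 : n < A ^ n := Nat.lt_pow_self (by omega)
      have h2 : A ^ n < N := Nat.lt_two_pow_self
      exact_mod_cast (by omega : n + 1 ≤ N)
    refine ⟨r, hr1, ?_, ?_⟩
    · have h1 : 1 - r ≤ 5 / ((n : ℝ) + 1) := by
        rw [le_div_iff₀ (by positivity)]
        exact (mul_le_mul_of_nonneg_left hnN (by linarith)).trans hup
      rw [mul_one_div]; linarith
    have hlogneg : Real.log (1 - r) < 0 := by
      refine Real.log_neg (by linarith) ?_
      have : 0 < r := Real.rpow_pos_of_pos (by linarith) _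
      linarith
    have hlog : |Real.log (1 - r)| ≤ 2 * (A : ℝ) ^ n := by
      rw [abs_of_neg hlogneg]
      have h1 := Real.log_le_log (by positivity) hlow
      have h2 : Real.log (N : ℝ) ≤ (A : ℝ) ^ n := by
        rw [hN]; push_cast
        rw [Real.log_pow]; push_cast
        have := Real.log_two_lt_d9
        nlinarith
      rw [Real.log_div (by norm_num) hNpos.ne'] at h1
      have h3 : -Real.log (2 / 3) ≤ 1 := by
        rw [← Real.log_inv]
        linarith [Real.log_le_sub_one_of_pos (show (0 : ℝ) < (2 / 3)⁻¹ by norm_num)]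
      linarith
    set z : ℂ := (r : ℂ) * Complex.exp (Complex.I * θ) with hz
    have hznorm : ‖z‖ = r := by
      rw [hz, norm_mul, mul_comm Complex.I, Complex.norm_exp_ofReal_mul_I, Complex.norm_real,
        Real.norm_of_nonneg hr0, mul_one]
    have hz1 : ‖z‖ < 1 := hznorm.trans_lt hr1
    have hmain : 1 ≤ h (z ^ N) := by
      rw [hz, mul_pow, ← Complex.ofReal_pow, hrN]; exact hs
    have hhead : -((A : ℝ) ^ n / 4)
        ≤ ∑ k ∈ Finset.range n, (A : ℝ) ^ k * h (z ^ 2 ^ A ^ k) := by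
      have h1 : ∑ k ∈ Finset.range n, -(B * (A : ℝ) ^ k)
          ≤ ∑ k ∈ Finset.range n, (A : ℝ) ^ k * h (z ^ 2 ^ A ^ k) := by
        refine Finset.sum_le_sum fun k _ => (neg_le_neg ?_).trans (neg_le_of_abs_le (hterm z hz1 k))
        exact mul_le_mul_of_nonneg_left (mul_le_of_le_one_right (by positivity)
          (pow_le_one₀ (norm_nonneg z) hz1.le)) hB.le
      rw [Finset.sum_neg_distrib, ← Finset.mul_sum] at h1
      have h2 := geom_sum_mul (A : ℝ) n
      have h3 : 0 ≤ ∑ k ∈ Finset.range n, (A : ℝ) ^ k := by positivity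
      nlinarith
    have htail : -(1 / 4) ≤ ∑' k : ℕ, (A : ℝ) ^ (k + (n + 1)) *
        h (z ^ 2 ^ A ^ (k + (n + 1))) := by
      have hlt : (A : ℝ)⁻¹ < 1 := inv_lt_one_of_one_lt₀ (by linarith)
      have hg : HasSum (fun k : ℕ => -(B * (A : ℝ)⁻¹) * (A : ℝ)⁻¹ ^ k)
          (-(B * (A : ℝ)⁻¹) * (1 - (A : ℝ)⁻¹)⁻¹) :=
        (hasSum_geometric_of_lt_one (by positivity) hlt).mul_left _
      have hle := hg.summable.tsum_le_tsum (fun k => ?_)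
        ((summable_nat_add_iff (n + 1)).2 (hsumm z hz1))
      · refine le_trans ?_ hle
        rw [hg.tsum_eq]
        have h1 : -(B * (A : ℝ)⁻¹) * (1 - (A : ℝ)⁻¹)⁻¹ = -(B / (A - 1)) := by
          have : (A : ℝ) - 1 ≠ 0 := by linarith
          field_simp
        rw [h1, neg_le_neg_iff, div_le_iff₀ (by linarith)]
        linarith
      · set m := k + (n + 1) with hm
        refine le_trans ?_ (neg_le_of_abs_le (hterm z hz1 m))
        have h1 : ‖z‖ ^ 2 ^ A ^ m ≤ ((A : ℝ) ^ m)⁻¹ ^ 2 := by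
          have hexp : 2 ^ A ^ m = N * 2 ^ (A ^ m - A ^ n) := by
            rw [hN, ← pow_add, Nat.add_sub_cancel' (Nat.pow_le_pow_right (by omega) (by omega))]
          rw [hexp, hznorm, pow_mul, hrN]
          exact (pow_le_pow_left₀ hs0 (by linarith) _).trans
            (half_pow_two_pow_le hA2 (by omega))
        have h2 : (A : ℝ) ^ m * ‖z‖ ^ 2 ^ A ^ m ≤ (A : ℝ)⁻¹ * (A : ℝ)⁻¹ ^ k := by
          calc (A : ℝ) ^ m * ‖z‖ ^ 2 ^ A ^ m ≤ (A : ℝ) ^ m * ((A : ℝ) ^ m)⁻¹ ^ 2 := by gcongr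
            _ = (A : ℝ)⁻¹ ^ m := by
                rw [sq, ← mul_assoc, mul_inv_cancel₀ (by positivity), one_mul, inv_pow]
            _ ≤ (A : ℝ)⁻¹ ^ (k + 1) :=
                pow_le_pow_of_le_one (by positivity) hlt.le (by omega)
            _ = _ := pow_succ' _ _
        rw [neg_mul, neg_le_neg_iff, mul_assoc]
        exact mul_le_mul_of_nonneg_left h2 hB.le
    rw [le_div_iff₀ (abs_pos.2 hlogneg.ne), ← (hsumm z hz1).sum_add_tsum_nat_add (n + 1),
      Finset.sum_range_succ]
    have hmid : (A : ℝ) ^ n ≤ (A : ℝ) ^ n * h (z ^ 2 ^ A ^ n) :=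
      le_mul_of_one_le_right (by positivity) hmain
    linarith
  choose r hr1 hrlow hr using key
  have htend : Tendsto r atTop (nhdsWithin 1 (Set.Iio 1)) := by
    refine tendsto_nhdsWithin_iff.2 ⟨?_, Eventually.of_forall hr1⟩
    refine tendsto_of_tendsto_of_tendsto_of_le_of_le ?_ tendsto_const_nhds hrlow
      (fun n => (hr1 n).le)
    simpa using (tendsto_one_div_add_atTop_nhds_zero_nat.const_mul (5 : ℝ)).const_sub 1
  exact htend.frequently (Frequently.of_forall fun n => by linarith [hr n])
end
end
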